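/- Any two evenly distributed outcomes of a singleton congestion game have the same total cost and the same maximum cost: if a, a' : N → M both satisfy |n_x − n_y| ≤ 1 for all resources x, y ∈ M, then c̄(a) = c̄(a') and ĉ(a) = ĉ(a'). -/

import Mathlib

/-- The load of resource `x` under outcome `a`: the number of players choosing `x`. -/
def load {N M : Type*} [Fintype N] [DecidableEq M] (a : N → M) (x : M) : ℕ :=
  (Finset.univ.filter fun i => a i = x).card

/-- The total cost of an outcome. -/
def totalCost {N M : Type*} [Fintype N] [DecidableEq M] (f : ℕ → ℚ) (a : N → M) : ℚ :=
  ∑ i, f (load a (a i))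

/-- The maximum cost incurred by any player under outcome `a`. -/
def maxCost {N M : Type*} [Fintype N] [Nonempty N] [DecidableEq M]
    (f : ℕ → ℚ) (a : N → M) : ℚ :=
  Finset.univ.sup' Finset.univ_nonempty fun i => f (load a (a i))

theorem sum_load {N M : Type*} [Fintype N] [Fintype M] [DecidableEq M] (a : N → M) :
    ∑ x, load a x = Fintype.card N :=
  (Finset.card_eq_sum_card_fiberwise fun i _ => Finset.mem_univ (a i)).symm

theorem load_apply_pos {N M : Type*} [Fintype N] [DecidableEq M] (a : N → M) (i : N) :
    0 < load a (a i) :=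
  Finset.card_pos.mpr ⟨i, by simp⟩

theorem exists_eq_of_load_pos {N M : Type*} [Fintype N] [DecidableEq M] {a : N → M} {x : M}
    (hx : 0 < load a x) : ∃ i, a i = x := by
  obtain ⟨i, hi⟩ := Finset.card_pos.mp hx
  exact ⟨i, (Finset.mem_filter.mp hi).2⟩

theorem totalCost_eq_sum_load_mul {N M : Type*} [Fintype N] [Fintype M] [DecidableEq M]
    (f : ℕ → ℚ) (a : N → M) : totalCost f a = ∑ x, (load a x : ℚ) * f (load a x) := by
  rw [totalCost, ← Finset.sum_fiberwise_of_maps_to fun i _ => Finset.mem_univ (a i)]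
  refine Finset.sum_congr rfl fun x _ => ?_
  rw [Finset.sum_congr rfl fun i hi => by rw [(Finset.mem_filter.mp hi).2],
    Finset.sum_const, nsmul_eq_mul, load]

/-- Nearly equal natural numbers differ by at most one from the floor of their average. -/
theorem eq_div_or_eq_div_add_one {M : Type*} [Fintype M] [Nonempty M] {u : M → ℕ}
    (hu : ∀ x y, u x ≤ u y + 1) (x : M) :
    u x = (∑ y, u y) / Fintype.card M ∨ u x = (∑ y, u y) / Fintype.card M + 1 := by
  set q := (∑ y, u y) / Fintype.card M with hq
  have hle : Fintype.card M * q ≤ ∑ y, u y := Nat.mul_div_le _ _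
  have hlt : ∑ y, u y < Fintype.card M * (q + 1) :=
    Nat.lt_mul_div_succ _ Fintype.card_pos
  have hconst (k : ℕ) : ∑ _y : M, k = Fintype.card M * k := by simp
  have hlower : q ≤ u x := by
    by_contra! h
    have : ∑ y, u y < ∑ _y : M, q :=
      Finset.sum_lt_sum (fun y _ => (hu y x).trans h) ⟨x, Finset.mem_univ x, h⟩
    rw [hconst] at this
    omega
  have hupper : u x ≤ q + 1 := by
    by_contra! h
    have : ∑ _y : M, (q + 1) ≤ ∑ y, u y :=
      Finset.sum_le_sum fun y _ => by have := hu x y; omega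
    rw [hconst] at this
    omega
  omega

/-- A function of nearly equal natural numbers has a sum depending only on their total. -/
theorem sum_comp_eq_of_nearly_equal {M : Type*} [Fintype M] [Nonempty M] {u : M → ℕ}
    (hu : ∀ x y, u x ≤ u y + 1) (g : ℕ → ℚ) {s : ℕ} (hs : ∑ x, u x = s) :
    ∑ x, g (u x) = Fintype.card M * g (s / Fintype.card M) +
      (s - Fintype.card M * (s / Fintype.card M : ℕ)) *
        (g (s / Fintype.card M + 1) - g (s / Fintype.card M)) := by
  have hdiv := eq_div_or_eq_div_add_one hu
  rw [hs] at hdiv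
  generalize s / Fintype.card M = q at hdiv ⊢
  have haffine (x : M) : g (u x) = g q + ((u x : ℚ) - q) * (g (q + 1) - g q) := by
    rcases hdiv x with h | h <;> rw [h] <;> push_cast <;> ring
  rw [Finset.sum_congr rfl fun x _ => haffine x, Finset.sum_add_distrib, ← Finset.sum_mul,
    Finset.sum_sub_distrib, ← Nat.cast_sum, hs]
  simp

theorem exists_le_of_nearly_equal {M : Type*} [Fintype M] {u v : M → ℕ}
    (hu : ∀ x y, u x ≤ u y + 1) (hs : ∑ x, u x = ∑ x, v x) (x : M) : ∃ y, u x ≤ v y := by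
  by_contra! h
  have : ∑ y, v y < ∑ y, u y :=
    Finset.sum_lt_sum (fun y _ => by have := h y; have := hu x y; omega)
      ⟨x, Finset.mem_univ x, h x⟩
  omega

theorem maxCost_le_of_nearly_equal {N M : Type*} [Fintype N] [Fintype M] [DecidableEq M]
    [Nonempty N] {f : ℕ → ℚ} (hf : Monotone f) {a : N → M}
    (ha : ∀ x y, load a x ≤ load a y + 1) (a' : N → M) : maxCost f a ≤ maxCost f a' := by
  refine Finset.sup'_le _ _ fun i _ => ?_
  obtain ⟨y, hy⟩ := exists_le_of_nearly_equal ha ((sum_load a).trans (sum_load a').symm) (a i)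
  obtain ⟨j, rfl⟩ := exists_eq_of_load_pos ((load_apply_pos a i).trans_le hy)
  exact (hf hy).trans
    (Finset.le_sup' (fun j => f (load a' (a' j))) (Finset.mem_univ j))

/-- Any two evenly distributed outcomes have the same total cost and the
same maximum cost. -/
theorem evenlyDistributed_costs_eq
    {N M : Type*} [Fintype N] [Fintype M] [DecidableEq M] [Nonempty N] [Nonempty M]
    (f : ℕ → ℚ)
    (hf_mono : ∀ k, f k < f (k + 1))
    (hf_conv : ∀ k, f (k + 1) - f k ≤ f (k + 2) - f (k + 1))
    (a a' : N → M)
    (heven : ∀ x y : M, |(load a x : ℤ) - (load a y : ℤ)| ≤ 1)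
    (heven' : ∀ x y : M, |(load a' x : ℤ) - (load a' y : ℤ)| ≤ 1) :
    totalCost f a = totalCost f a' ∧ maxCost f a = maxCost f a' := by
  have ha (x y : M) : load a x ≤ load a y + 1 := by
    have := (abs_le.mp (heven x y)).2
    omega
  have ha' (x y : M) : load a' x ≤ load a' y + 1 := by
    have := (abs_le.mp (heven' x y)).2
    omega
  have hf : Monotone f := monotone_nat_of_le_succ fun k => (hf_mono k).le
  refine ⟨?_, (maxCost_le_of_nearly_equal hf ha a').antisymm
    (maxCost_le_of_nearly_equal hf ha' a)⟩
  rw [totalCost_eq_sum_load_mul, totalCost_eq_sum_load_mul,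
    sum_comp_eq_of_nearly_equal ha (fun k => (k : ℚ) * f k) (sum_load a),
    sum_comp_eq_of_nearly_equal ha' (fun k => (k : ℚ) * f k) (sum_load a')]
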